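/- arXiv:1105.2728 — 2 statements merged into one kernel-verified Lean document; each statement's English description precedes it below -/
import Mathlib

section
/- Theorem 2: For λ ∈ ℝ³, the 4×4 matrix τ(λ) := (1/4)(I ⊗ I + Σ_{i=1}^3 λ_i σ_i ⊗ σ_iᵀ) is positive semidefinite if and only if 1 + λ·e_μ ≥ 0 for all μ = 0,1,2,3, i.e. if and only if Q_n(λ) is a doubly stochastic matrix; equivalently, E_{Q_n(λ)} is a completely positive unital map if and only if Q_n(λ) is doubly stochastic. -/
open Matrix Finset

/-- The four vectors `e_μ ∈ ℝ³` pointing to the corners of the Bloch tetrahedron. -/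
noncomputable def e : Fin 4 → Fin 3 → ℝ :=
  ![![1, 1, 1], ![1, -1, -1], ![-1, 1, -1], ![-1, -1, 1]]

/-- The Pauli matrices `σ₁, σ₂, σ₃`. -/
noncomputable def σ : Fin 3 → Matrix (Fin 2) (Fin 2) ℂ :=
  ![!![0, 1; 1, 0], !![0, -Complex.I; Complex.I, 0], !![1, 0; 0, -1]]

/-- The matrices `A_μ = (1/2)(I + e_μ·σ)`. -/
noncomputable def A (μ : Fin 4) : Matrix (Fin 2) (Fin 2) ℂ :=
  (1 / 2 : ℂ) • ((1 : Matrix (Fin 2) (Fin 2) ℂ) + ∑ i, (e μ i : ℂ) • σ i)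

/-- The map `E_Q(ρ) = (1/2) Σ_{μν} Q_{μν} tr(ρ A_ν) A_μ` associated to a 4×4 real matrix. -/
noncomputable def chan (Q : Matrix (Fin 4) (Fin 4) ℝ) (ρ : Matrix (Fin 2) (Fin 2) ℂ) :
    Matrix (Fin 2) (Fin 2) ℂ :=
  (1 / 2 : ℂ) • ∑ μ, ∑ ν, (Q μ ν : ℂ) • ((ρ * A ν).trace • A μ)

open Kronecker
open scoped ComplexOrder

/-- The four-dimensional vectors `|e_μ⟩ = (1/2)(1, e_μ)ᵀ`. -/
noncomputable def ketE (μ : Fin 4) : Fin 4 → ℝ :=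
  (1 / 2 : ℝ) • (Fin.cons (1 : ℝ) (e μ) : Fin 4 → ℝ)

/-- The normal form `Q_n(λ) = |e_0⟩⟨e_0| + Σᵢ λᵢ |e_i⟩⟨e_i|`. -/
noncomputable def Qn (l : Fin 3 → ℝ) : Matrix (Fin 4) (Fin 4) ℝ :=
  vecMulVec (ketE 0) (ketE 0) + ∑ i : Fin 3, l i • vecMulVec (ketE i.succ) (ketE i.succ)

/-- The Choi–Jamiolkowski matrix `τ(λ) = (1/4)(I ⊗ I + Σᵢ λᵢ σᵢ ⊗ σᵢᵀ)` of `E_{Q_n(λ)}`. -/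
noncomputable def τ (l : Fin 3 → ℝ) : Matrix (Fin 2 × Fin 2) (Fin 2 × Fin 2) ℂ :=
  (1 / 4 : ℂ) • ((1 : Matrix (Fin 2) (Fin 2) ℂ) ⊗ₖ (1 : Matrix (Fin 2) (Fin 2) ℂ)
    + ∑ i, (l i : ℂ) • (σ i ⊗ₖ (σ i)ᵀ))

/-- The (unnormalised) Bell vectors, eigenvectors of `τ`. -/
noncomputable def bell : Fin 4 → Fin 2 × Fin 2 → ℂ :=
  ![fun p => !![1, 0; 0, 1] p.1 p.2, fun p => !![0, 1; 1, 0] p.1 p.2,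
    fun p => !![0, 1; -1, 0] p.1 p.2, fun p => !![1, 0; 0, -1] p.1 p.2]

theorem tau_decomp (l : Fin 3 → ℝ) :
    τ l = ∑ μ, ((1 / 8 * (1 + ∑ i, e μ i * l i) : ℝ) : ℂ) •
      vecMulVec (bell μ) (star (bell μ)) := by
  ext ⟨a, b⟩ ⟨c, d⟩
  fin_cases a <;> fin_cases b <;> fin_cases c <;> fin_cases d <;>
    simp [τ, σ, e, bell, Fin.sum_univ_succ, vecMulVec_apply, Matrix.one_apply] <;> ring

theorem bell_quad (l : Fin 3 → ℝ) (μ : Fin 4) :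
    star (bell μ) ⬝ᵥ (τ l *ᵥ bell μ) = ((1 / 2 * (1 + ∑ i, e μ i * l i) : ℝ) : ℂ) := by
  fin_cases μ <;>
    simp [τ, σ, e, bell, Fin.sum_univ_succ, dotProduct, mulVec, Fintype.sum_prod_type,
      Matrix.one_apply] <;> ring

theorem tau_iff (l : Fin 3 → ℝ) :
    (τ l).PosSemidef ↔ ∀ μ : Fin 4, 0 ≤ 1 + ∑ i, e μ i * l i := by
  constructor
  · intro h μ
    have h1 := h.dotProduct_mulVec_nonneg (bell μ)
    rw [bell_quad, Complex.zero_le_real] at h1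
    linarith
  · intro h
    rw [tau_decomp]
    refine posSemidef_sum _ fun μ _ => ?_
    refine (posSemidef_vecMulVec_self_star _).smul ?_
    rw [Complex.zero_le_real]
    have := h μ
    positivity

theorem Qn_iff (l : Fin 3 → ℝ) :
    (∀ μ : Fin 4, 0 ≤ 1 + ∑ i, e μ i * l i) ↔
      (∀ μ ν, 0 ≤ Qn l μ ν) ∧ (∀ μ, ∑ ν, Qn l μ ν = 1) ∧ (∀ ν, ∑ μ, Qn l μ ν = 1) := by
  constructor
  · intro h
    have h0 := h 0
    have h1 := h 1
    have h2 := h 2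
    have h3 := h 3
    simp [e, Fin.sum_univ_succ] at h0 h1 h2 h3
    refine ⟨fun μ ν => ?_, fun μ => ?_, fun μ => ?_⟩
    · fin_cases μ <;> fin_cases ν <;>
        simp [Qn, ketE, e, Fin.sum_univ_succ, vecMulVec_apply, Fin.cons] <;> linarith
    · fin_cases μ <;>
        simp [Qn, ketE, e, Fin.sum_univ_succ, vecMulVec_apply, Fin.cons] <;> ring
    · fin_cases μ <;>
        simp [Qn, ketE, e, Fin.sum_univ_succ, vecMulVec_apply, Fin.cons] <;> ring
  · rintro ⟨h, -, -⟩ μ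
    have h0 := h μ 0
    fin_cases μ <;>
      simp [Qn, ketE, e, Fin.sum_univ_succ, vecMulVec_apply, Fin.cons] at h0 ⊢ <;> linarith

/-- Theorem 2: the Choi matrix `τ(λ)` is positive semidefinite (i.e. `E_{Q_n(λ)}` is a
completely positive unital map) iff `1 + λ·e_μ ≥ 0` for all `μ`, iff `Q_n(λ)` is a
doubly stochastic matrix. -/
theorem τ_posSemidef_iff_Qn_doublyStochastic (l : Fin 3 → ℝ) :
    ((τ l).PosSemidef ↔ ∀ μ : Fin 4, 0 ≤ 1 + ∑ i, e μ i * l i) ∧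
      ((τ l).PosSemidef ↔
        (∀ μ ν, 0 ≤ Qn l μ ν) ∧ (∀ μ, ∑ ν, Qn l μ ν = 1) ∧ (∀ ν, ∑ μ, Qn l μ ν = 1)) := by
  exact ⟨tau_iff l, (tau_iff l).trans (Qn_iff l)⟩
end

section
/- Theorem 3 (concrete form): Let h ∈ ℝ³, let M(h) := (1/2) Σ_{i=1}^3 h_i σ_i ⊗ σ_iᵀ, let |ω⟩ = (1/√2)(|00⟩ + |11⟩), and let ω⊥ := I − |ω⟩⟨ω| be the orthogonal projection onto the complement of ω. Then ω⊥ M(h) ω⊥ is positive semidefinite if and only if h·e_i ≥ 0 for all i = 1,2,3, i.e. if and only if all off-diagonal entries of the 4×4 matrix H_n(h) := Σ_{i=1}^3 h_i |e_i⟩⟨e_i| are nonnegative (the condition for H_n(h) to generate a classical stochastic process). -/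
open Matrix Finset

open Kronecker
open scoped ComplexOrder

/-- The normal form generator `H_n(h) = Σᵢ hᵢ |e_i⟩⟨e_i|`. -/
noncomputable def Hn (h : Fin 3 → ℝ) : Matrix (Fin 4) (Fin 4) ℝ :=
  ∑ i : Fin 3, h i • vecMulVec (ketE i.succ) (ketE i.succ)

/-- The maximally entangled state `|ω⟩ = (1/√2)(|00⟩ + |11⟩)`. -/
noncomputable def ω : Fin 2 × Fin 2 → ℂ :=
  fun p => if p.1 = p.2 then ((1 / Real.sqrt 2 : ℝ) : ℂ) else 0

/-- The projection `ω⊥ = I - |ω⟩⟨ω|` onto the orthogonal complement of `|ω⟩`. -/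
noncomputable def omegaPerp : Matrix (Fin 2 × Fin 2) (Fin 2 × Fin 2) ℂ :=
  1 - Matrix.vecMulVec ω (star ω)

/-- The matrix `M(h) = (1/2) Σᵢ hᵢ σᵢ ⊗ σᵢᵀ` (the `Γ`-involution of the linearized
form of `E_{H_n(h)}`). -/
noncomputable def Mh (h : Fin 3 → ℝ) : Matrix (Fin 2 × Fin 2) (Fin 2 × Fin 2) ℂ :=
  (1 / 2 : ℂ) • ∑ i, (h i : ℂ) • (σ i ⊗ₖ (σ i)ᵀ)

/-- Unnormalised Bell vectors orthogonal to `ω`. -/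
noncomputable def bellU (k : Fin 3) : Fin 2 × Fin 2 → ℂ :=
  fun p => ![!![0, 1; 1, 0], !![0, 1; -1, 0], !![1, 0; 0, -1]] k p.1 p.2

lemma omega_proj : Matrix.vecMulVec ω (star ω) =
    Matrix.of fun p q : Fin 2 × Fin 2 => if p.1 = p.2 ∧ q.1 = q.2 then (1 / 2 : ℂ) else 0 := by
  have h2 : ((1 / Real.sqrt 2 : ℝ) : ℂ) * ((1 / Real.sqrt 2 : ℝ) : ℂ) = 1 / 2 := by
    rw [← Complex.ofReal_mul]
    have : (1 / Real.sqrt 2) * (1 / Real.sqrt 2) = (1 / 2 : ℝ) := by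
      rw [div_mul_div_comm, Real.mul_self_sqrt (by norm_num)]; norm_num
    rw [this]; norm_num
  ext ⟨a, b⟩ ⟨c, d⟩
  simp only [vecMulVec_apply, ω, Pi.star_apply, Matrix.of_apply]
  by_cases h1 : a = b <;> by_cases h3 : c = d <;> simp only [h1, h3, if_true, if_false,
    star_zero, mul_zero, zero_mul, and_true, and_false, and_self]
  rw [Complex.star_def, Complex.conj_ofReal, h2]

lemma decomp (h : Fin 3 → ℝ) : omegaPerp * Mh h * omegaPerp =
    ∑ k : Fin 3, (((1 / 4 : ℝ) * ∑ j, h j * e k.succ j : ℝ) : ℂ) •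
      vecMulVec (bellU k) (star (bellU k)) := by
  rw [omegaPerp, omega_proj]
  ext ⟨a, b⟩ ⟨c, d⟩
  fin_cases a <;> fin_cases b <;> fin_cases c <;> fin_cases d <;>
  · simp [Mh, σ, e, bellU, Matrix.mul_apply, Fintype.sum_prod_type, Fin.sum_univ_succ,
      Matrix.one_apply, vecMulVec_apply, kroneckerMap_apply, Matrix.sum_apply]
    try ring_nf
    try simp
    try ring

lemma psd_iff (h : Fin 3 → ℝ) : (omegaPerp * Mh h * omegaPerp).PosSemidef ↔
    ∀ i : Fin 3, 0 ≤ ∑ j, h j * e i.succ j := by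
  rw [decomp]
  constructor
  · intro H i
    have key := H.dotProduct_mulVec_nonneg (bellU i)
    generalize hc : (fun k : Fin 3 => ∑ j, h j * e k.succ j) = c at *
    have hc' : ∀ k : Fin 3, ∑ j, h j * e k.succ j = c k := fun k => congrFun hc k
    simp only [hc'] at key ⊢
    have e1 : star (bellU i) ⬝ᵥ ((∑ k : Fin 3, (((1 / 4 : ℝ) * c k : ℝ) : ℂ) •
      vecMulVec (bellU k) (star (bellU k))) *ᵥ bellU i) = ((c i : ℝ) : ℂ) := by
      fin_cases i <;>
      · simp [bellU, Matrix.mulVec, dotProduct, Fintype.sum_prod_type, Fin.sum_univ_succ,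
          vecMulVec_apply, Matrix.sum_apply]
        try ring
    rw [e1] at key
    exact_mod_cast key
  · intro H
    refine Matrix.posSemidef_sum _ fun k _ => ?_
    refine (Matrix.posSemidef_vecMulVec_self_star (bellU k)).smul ?_
    have := H k
    exact_mod_cast (by positivity : (0 : ℝ) ≤ (1 / 4 : ℝ) * ∑ j, h j * e k.succ j)

lemma hn_iff (h : Fin 3 → ℝ) : (∀ i : Fin 3, 0 ≤ ∑ j, h j * e i.succ j) ↔
    ∀ μ ν, μ ≠ ν → 0 ≤ Hn h μ ν := by
  simp [Fin.forall_fin_succ, Hn, ketE, e, Fin.sum_univ_succ, Matrix.sum_apply, vecMulVec_apply]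
  constructor
  · rintro ⟨h1, h2, h3⟩
    refine ⟨⟨?_, ?_, ?_⟩, ⟨?_, ?_, ?_⟩, ⟨?_, ?_, ?_⟩, ?_, ?_, ?_⟩ <;> linarith
  · rintro ⟨⟨h1, h2, h3⟩, -⟩
    refine ⟨?_, ?_, ?_⟩ <;> linarith

/-- Theorem 3 (concrete form): `ω⊥ M(h) ω⊥` is positive semidefinite (the condition for
`E_{H_n(h)}` to be a Lindblad generator) iff `h·e_i ≥ 0` for `i = 1,2,3`, iff all
off-diagonal entries of `H_n(h)` are nonnegative (the condition for `H_n(h)` to generate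
a classical stochastic process). -/
theorem lindblad_iff_classical_generator (h : Fin 3 → ℝ) :
    ((omegaPerp * Mh h * omegaPerp).PosSemidef ↔
        ∀ i : Fin 3, 0 ≤ ∑ j, h j * e i.succ j) ∧
      ((omegaPerp * Mh h * omegaPerp).PosSemidef ↔
        ∀ μ ν, μ ≠ ν → 0 ≤ Hn h μ ν) := by
  exact ⟨psd_iff h, (psd_iff h).trans (hn_iff h)⟩
end
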